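/- (Lemma 1, first part.) Let 0 < ρ < 1 and ε = ε_Λ(√(ρ(1−ρ)/(1+ρ))). If ε < 1/2, then the L¹ (variation) distance between the mixture density and the bivariate Gaussian density is bounded as ∫_{ℝ²} |f_{X̄,Ȳ}(x,y) − f_{X,Y}(x,y)| dx dy ≤ 4ε. -/

import Mathlib

open Real

/-- The centered Gaussian density with standard deviation `σ`. -/
noncomputable def gpdf (σ x : ℝ) : ℝ :=
  (1 / (Real.sqrt (2 * Real.pi) * σ)) * Real.exp (-(x ^ 2) / (2 * σ ^ 2))

/-- The discrete Gaussian distribution over the lattice `Λ = bℤ` with parameter `σ`,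
evaluated at the lattice point `b * k`. -/
noncomputable def dgauss (b σ : ℝ) (k : ℤ) : ℝ :=
  gpdf σ (b * k) / ∑' j : ℤ, gpdf σ (b * j)

/-- The flatness factor of the lattice `Λ = bℤ` at parameter `σ`. -/
noncomputable def flatness (b σ : ℝ) : ℝ :=
  ⨆ x : ℝ, |b * (∑' k : ℤ, gpdf σ (x - b * k)) - 1|

/-- The bivariate Gaussian density with unit variances and correlation `ρ`. -/
noncomputable def fXY (ρ x y : ℝ) : ℝ :=
  (1 / (2 * Real.pi * Real.sqrt (1 - ρ ^ 2))) *
    Real.exp (-(x ^ 2 + y ^ 2 - 2 * ρ * x * y) / (2 * (1 - ρ ^ 2)))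

/-- The density of `(W̄ + √(1-ρ)N₁, W̄ + √(1-ρ)N₂)` where `W̄ ~ D_{Λ,√ρ}`, `Λ = bℤ`. -/
noncomputable def fXbarYbar (ρ b x y : ℝ) : ℝ :=
  ∑' k : ℤ, dgauss b (Real.sqrt ρ) k * gpdf (Real.sqrt (1 - ρ)) (x - b * k) *
    gpdf (Real.sqrt (1 - ρ)) (y - b * k)

lemma gpdf_pos {σ : ℝ} (hσ : 0 < σ) (x : ℝ) : 0 < gpdf σ x := by
  unfold gpdf; positivity

lemma gpdf_eq_const_mul_exp (σ x : ℝ) :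
    gpdf σ x = (1 / (√(2 * π) * σ)) * exp (-(1 / (2 * σ ^ 2)) * x ^ 2) := by
  unfold gpdf; congr 2; ring

lemma integrable_gpdf {σ : ℝ} (hσ : 0 < σ) : MeasureTheory.Integrable (gpdf σ) := by
  rw [funext (gpdf_eq_const_mul_exp σ)]
  exact (integrable_exp_neg_mul_sq (by positivity)).const_mul _

lemma integral_gpdf {σ : ℝ} (hσ : 0 < σ) : ∫ x, gpdf σ x = 1 := by
  simp_rw [gpdf_eq_const_mul_exp σ]
  rw [MeasureTheory.integral_const_mul, integral_gaussian,
    show π / (1 / (2 * σ ^ 2)) = 2 * π * σ ^ 2 by field_simp,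
    Real.sqrt_mul (by positivity : (0 : ℝ) ≤ 2 * π), Real.sqrt_sq hσ.le]
  field_simp

lemma summable_exp_neg_mul_int_sq {c : ℝ} (hc : 0 < c) :
    Summable fun k : ℤ => exp (-(c * (k : ℝ) ^ 2)) := by
  have hnat : Summable fun n : ℕ => exp (-(c * (n : ℝ) ^ 2)) := by
    refine (Real.summable_exp_nat_mul_iff.2 (neg_lt_zero.2 hc)).of_nonneg_of_le
      (fun _ => (exp_pos _).le) fun n => exp_le_exp.2 ?_
    have h : (n : ℝ) ≤ (n : ℝ) ^ 2 := by exact_mod_cast Nat.le_self_pow two_ne_zero n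
    nlinarith
  exact Summable.of_nat_of_neg (by simpa using hnat) (by simpa using hnat)

/-- A lattice Gaussian sum is dominated, uniformly in a shift `|x| ≤ b`, by a summable sequence. -/
lemma gpdf_sub_le {b σ x : ℝ} (hσ : 0 < σ) (hx : x ^ 2 ≤ b ^ 2) (k : ℤ) :
    gpdf σ (x - b * k) ≤ (1 / (√(2 * π) * σ)) * exp (b ^ 2 / (2 * σ ^ 2)) *
      exp (-(b ^ 2 / (4 * σ ^ 2) * (k : ℝ) ^ 2)) := by
  rw [gpdf, mul_assoc, ← exp_add]
  refine mul_le_mul_of_nonneg_left (exp_le_exp.2 ?_) (by positivity)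
  rw [show b ^ 2 / (2 * σ ^ 2) + -(b ^ 2 / (4 * σ ^ 2) * (k : ℝ) ^ 2) =
    (b ^ 2 - b ^ 2 * (k : ℝ) ^ 2 / 2) / (2 * σ ^ 2) by field_simp; ring]
  gcongr
  nlinarith [sq_nonneg (2 * x - b * k)]

lemma summable_gpdf_dominant {b σ : ℝ} (hb : 0 < b) (hσ : 0 < σ) :
    Summable fun k : ℤ => (1 / (√(2 * π) * σ)) * exp (b ^ 2 / (2 * σ ^ 2)) *
      exp (-(b ^ 2 / (4 * σ ^ 2) * (k : ℝ) ^ 2)) :=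
  (summable_exp_neg_mul_int_sq (by positivity)).mul_left _

lemma summable_gpdf {b σ : ℝ} (hb : 0 < b) (hσ : 0 < σ) :
    Summable fun k : ℤ => gpdf σ (b * k) := by
  refine (summable_gpdf_dominant hb hσ).of_nonneg_of_le (fun k => (gpdf_pos hσ _).le) fun k => ?_
  have h := gpdf_sub_le (b := b) (x := 0) hσ (by simpa using sq_nonneg b) k
  simpa [gpdf] using h

lemma tsum_gpdf_sub_add_mul (b σ x : ℝ) (n : ℤ) :
    ∑' k : ℤ, gpdf σ (x + b * n - b * k) = ∑' k : ℤ, gpdf σ (x - b * k) := by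
  rw [← (Equiv.addRight n).tsum_eq fun k : ℤ => gpdf σ (x + b * n - b * k)]
  refine tsum_congr fun k => ?_
  simp only [Equiv.coe_addRight, Int.cast_add]
  congr 1; ring

lemma exists_tsum_gpdf_le {b σ : ℝ} (hb : 0 < b) (hσ : 0 < σ) :
    ∃ C, ∀ x, ∑' k : ℤ, gpdf σ (x - b * k) ≤ C := by
  refine ⟨∑' k : ℤ, (1 / (√(2 * π) * σ)) * exp (b ^ 2 / (2 * σ ^ 2)) *
    exp (-(b ^ 2 / (4 * σ ^ 2) * (k : ℝ) ^ 2)), fun x => ?_⟩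
  rw [← sub_add_cancel x (b * (⌊x / b⌋ : ℤ)), tsum_gpdf_sub_add_mul]
  have h0 : 0 ≤ x - b * ⌊x / b⌋ := by
    have := (le_div_iff₀ hb).1 (Int.floor_le (x / b)); linarith
  have h1 : x - b * ⌊x / b⌋ ≤ b := by
    have := (div_lt_iff₀ hb).1 (Int.lt_floor_add_one (x / b)); linarith
  have hle := gpdf_sub_le (b := b) hσ (pow_le_pow_left₀ h0 h1 2)
  exact Summable.tsum_le_tsum hle
    ((summable_gpdf_dominant hb hσ).of_nonneg_of_le (fun k => (gpdf_pos hσ _).le) hle)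
    (summable_gpdf_dominant hb hσ)

lemma abs_sub_one_le_flatness {b σ : ℝ} (hb : 0 < b) (hσ : 0 < σ) (x : ℝ) :
    |b * (∑' k : ℤ, gpdf σ (x - b * k)) - 1| ≤ flatness b σ := by
  obtain ⟨C, hC⟩ := exists_tsum_gpdf_le hb hσ
  refine le_ciSup (f := fun x => |b * (∑' k : ℤ, gpdf σ (x - b * k)) - 1|) ⟨b * C + 1, ?_⟩ x
  rintro _ ⟨y, rfl⟩
  have h0 : 0 ≤ ∑' k : ℤ, gpdf σ (y - b * k) := tsum_nonneg fun k => (gpdf_pos hσ _).le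
  refine abs_le.2 ⟨?_, ?_⟩ <;> nlinarith [hC y]

lemma fXY_eq_mul {ρ : ℝ} (h0 : 0 < ρ) (h1 : ρ < 1) (x y : ℝ) :
    fXY ρ x y = gpdf 1 x * gpdf √(1 - ρ ^ 2) (y - ρ * x) := by
  have h : 0 < 1 - ρ ^ 2 := by nlinarith
  have h2 : √(2 * π) * √(2 * π) = 2 * π := mul_self_sqrt (by positivity)
  unfold fXY gpdf
  rw [mul_mul_mul_comm, ← exp_add, Real.sq_sqrt h.le]
  congr 1
  · generalize √(2 * π) = c at h2 ⊢
    rw [← h2]; field_simp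
  · congr 1; field_simp; ring

lemma fXY_pos {ρ : ℝ} (h0 : 0 < ρ) (h1 : ρ < 1) (x y : ℝ) : 0 < fXY ρ x y := by
  have h : 0 < 1 - ρ ^ 2 := by nlinarith
  unfold fXY; positivity

lemma integrable_fXY {ρ : ℝ} (h0 : 0 < ρ) (h1 : ρ < 1) :
    MeasureTheory.Integrable fun p : ℝ × ℝ => fXY ρ p.1 p.2 := by
  have h : 0 < √(1 - ρ ^ 2) := Real.sqrt_pos.2 (by nlinarith)
  have hc : Continuous fun p : ℝ × ℝ => fXY ρ p.1 p.2 := by unfold fXY; fun_prop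
  rw [MeasureTheory.Measure.volume_eq_prod,
    MeasureTheory.integrable_prod_iff hc.aestronglyMeasurable]
  simp_rw [Real.norm_of_nonneg (fXY_pos h0 h1 _ _).le, fXY_eq_mul h0 h1,
    MeasureTheory.integral_const_mul, MeasureTheory.integral_sub_right_eq_self (gpdf _),
    integral_gpdf h, mul_one]
  exact ⟨.of_forall fun x => ((integrable_gpdf h).comp_sub_right _).const_mul _,
    integrable_gpdf one_pos⟩

lemma integral_fXY {ρ : ℝ} (h0 : 0 < ρ) (h1 : ρ < 1) :
    ∫ p : ℝ × ℝ, fXY ρ p.1 p.2 = 1 := by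
  have h : 0 < √(1 - ρ ^ 2) := Real.sqrt_pos.2 (by nlinarith)
  rw [MeasureTheory.Measure.volume_eq_prod, MeasureTheory.integral_prod _ (integrable_fXY h0 h1)]
  simp_rw [fXY_eq_mul h0 h1, MeasureTheory.integral_const_mul,
    MeasureTheory.integral_sub_right_eq_self (gpdf _), integral_gpdf h, mul_one]
  exact integral_gpdf one_pos

/-- Completing the square: the joint density of `(W, W + √(1-ρ)N₁, W + √(1-ρ)N₂)` factors as the
density of the last two coordinates times the conditional density of `W`. -/
lemma gpdf_mul_gpdf_mul_gpdf {ρ : ℝ} (h0 : 0 < ρ) (h1 : ρ < 1) (a x y : ℝ) :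
    gpdf √ρ a * (gpdf √(1 - ρ) (x - a) * gpdf √(1 - ρ) (y - a)) =
      fXY ρ x y * gpdf √(ρ * (1 - ρ) / (1 + ρ)) (ρ / (1 + ρ) * (x + y) - a) := by
  have h : 0 < 1 - ρ := by linarith
  have h' : 0 < 1 + ρ := by linarith
  have hsq : 1 - ρ ^ 2 = (1 - ρ) * (1 + ρ) := by ring
  have h2 : √(2 * π) * √(2 * π) = 2 * π := mul_self_sqrt (by positivity)
  unfold fXY gpdf
  rw [mul_mul_mul_comm _ _ (1 / (√(2 * π) * √(1 - ρ))), ← exp_add, mul_mul_mul_comm, ← exp_add,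
    mul_mul_mul_comm, ← exp_add, Real.sq_sqrt h0.le, Real.sq_sqrt h.le, Real.sq_sqrt (by positivity),
    hsq, Real.sqrt_mul h.le, Real.sqrt_div (by positivity), Real.sqrt_mul h0.le]
  congr 1
  · generalize √(2 * π) = c at h2 ⊢
    rw [← h2]; field_simp
  · congr 1; field_simp; ring

/-- The Gaussian mass of the lattice at the larger parameter `√ρ` is an average, with weight `fXY`,
of shifted lattice masses at the smaller parameter. -/
lemma integral_fXY_mul_tsum_gpdf {ρ b : ℝ} (hb : 0 < b) (h0 : 0 < ρ) (h1 : ρ < 1) :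
    ∫ p : ℝ × ℝ, fXY ρ p.1 p.2 *
        ∑' k : ℤ, gpdf √(ρ * (1 - ρ) / (1 + ρ)) (ρ / (1 + ρ) * (p.1 + p.2) - b * k) =
      ∑' k : ℤ, gpdf √ρ (b * k) := by
  have hσ : 0 < √(1 - ρ) := Real.sqrt_pos.2 (by linarith)
  have hρ : 0 < √ρ := Real.sqrt_pos.2 h0
  let g : ℤ → ℝ × ℝ → ℝ := fun k p =>
    gpdf √ρ (b * k) * (gpdf √(1 - ρ) (p.1 - b * k) * gpdf √(1 - ρ) (p.2 - b * k))
  have hg_int (k : ℤ) : MeasureTheory.Integrable (g k) :=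
    (((integrable_gpdf hσ).comp_sub_right (b * k)).mul_prod
      ((integrable_gpdf hσ).comp_sub_right (b * k))).const_mul _
  have hg_integral (k : ℤ) : ∫ p, g k p = gpdf √ρ (b * k) := by
    simp only [g]
    rw [MeasureTheory.integral_const_mul, MeasureTheory.Measure.volume_eq_prod,
      MeasureTheory.integral_prod_mul (fun x => gpdf √(1 - ρ) (x - b * k))
        (fun x => gpdf √(1 - ρ) (x - b * k)),
      MeasureTheory.integral_sub_right_eq_self (gpdf _), integral_gpdf hσ, mul_one, mul_one]
  have hg_norm (k : ℤ) (p : ℝ × ℝ) : ‖g k p‖ = g k p :=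
    Real.norm_of_nonneg
      (mul_pos (gpdf_pos hρ _) (mul_pos (gpdf_pos hσ _) (gpdf_pos hσ _))).le
  have key := MeasureTheory.integral_tsum_of_summable_integral_norm hg_int
    (by simpa only [hg_norm, hg_integral] using summable_gpdf hb hρ)
  simp only [hg_integral] at key
  rw [key]
  refine MeasureTheory.integral_congr_ae (.of_forall fun p => ?_)
  simp only [g, gpdf_mul_gpdf_mul_gpdf h0 h1, tsum_mul_left]

lemma abs_mul_tsum_gpdf_sub_one_le {ρ b : ℝ} (hb : 0 < b) (h0 : 0 < ρ) (h1 : ρ < 1) :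
    |b * (∑' k : ℤ, gpdf √ρ (b * k)) - 1| ≤ flatness b √(ρ * (1 - ρ) / (1 + ρ)) := by
  have hs : 0 < √(ρ * (1 - ρ) / (1 + ρ)) :=
    Real.sqrt_pos.2 (div_pos (mul_pos h0 (by linarith)) (by linarith))
  have hρ : 0 < √ρ := Real.sqrt_pos.2 h0
  have hD : 0 < ∑' k : ℤ, gpdf √ρ (b * k) :=
    (summable_gpdf hb hρ).tsum_pos (fun k => (gpdf_pos hρ _).le) 0 (gpdf_pos hρ _)
  rw [← integral_fXY_mul_tsum_gpdf hb h0 h1] at hD ⊢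
  have hint := (MeasureTheory.Integrable.of_integral_ne_zero hD.ne').const_mul b
  have hf := integrable_fXY h0 h1
  have hsub := MeasureTheory.integral_sub hint hf
  have hmul := MeasureTheory.integral_const_mul (μ := MeasureTheory.volume)
    (flatness b √(ρ * (1 - ρ) / (1 + ρ))) fun p : ℝ × ℝ => fXY ρ p.1 p.2
  rw [MeasureTheory.integral_const_mul, integral_fXY h0 h1] at hsub
  rw [integral_fXY h0 h1, mul_one] at hmul
  rw [← hsub, ← Real.norm_eq_abs, ← hmul]
  refine MeasureTheory.norm_integral_le_of_norm_le (hf.const_mul _) (.of_forall fun p => ?_)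
  rw [mul_left_comm, ← mul_sub_one, norm_mul, Real.norm_of_nonneg (fXY_pos h0 h1 _ _).le, mul_comm]
  exact mul_le_mul_of_nonneg_right (abs_sub_one_le_flatness hb hs _) (fXY_pos h0 h1 _ _).le

lemma fXbarYbar_eq {ρ : ℝ} (b : ℝ) (h0 : 0 < ρ) (h1 : ρ < 1) (x y : ℝ) :
    fXbarYbar ρ b x y = fXY ρ x y *
      ((∑' k : ℤ, gpdf √(ρ * (1 - ρ) / (1 + ρ)) (ρ / (1 + ρ) * (x + y) - b * k)) /
        ∑' k : ℤ, gpdf √ρ (b * k)) := by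
  rw [← mul_div_assoc, ← tsum_mul_left, ← tsum_div_const]
  refine tsum_congr fun k => ?_
  rw [← gpdf_mul_gpdf_mul_gpdf h0 h1, dgauss]
  ring

/-- Lemma 1, first part: if `ε = ε_Λ(√(ρ(1-ρ)/(1+ρ))) < 1/2`, then the
L¹ (variation) distance between the mixture density and the bivariate Gaussian density is
at most `4ε`. -/
theorem variation_distance_le (ρ b : ℝ) (hb : 0 < b) (hρ0 : 0 < ρ) (hρ1 : ρ < 1)
    (hε : flatness b (Real.sqrt (ρ * (1 - ρ) / (1 + ρ))) < 1 / 2) :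
    ∫ p : ℝ × ℝ, |fXbarYbar ρ b p.1 p.2 - fXY ρ p.1 p.2| ≤
      4 * flatness b (Real.sqrt (ρ * (1 - ρ) / (1 + ρ))) := by
  have hs : 0 < √(ρ * (1 - ρ) / (1 + ρ)) :=
    Real.sqrt_pos.2 (div_pos (mul_pos hρ0 (by linarith)) (by linarith))
  have hD := abs_le.1 (abs_mul_tsum_gpdf_sub_one_le hb hρ0 hρ1)
  have hmul := MeasureTheory.integral_const_mul (μ := MeasureTheory.volume)
    (4 * flatness b √(ρ * (1 - ρ) / (1 + ρ))) fun p : ℝ × ℝ => fXY ρ p.1 p.2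
  rw [integral_fXY hρ0 hρ1, mul_one] at hmul
  rw [← hmul]
  refine MeasureTheory.integral_mono_of_nonneg (.of_forall fun p => abs_nonneg _)
    ((integrable_fXY hρ0 hρ1).const_mul _) (.of_forall fun p => ?_)
  have hN := abs_le.1 (abs_sub_one_le_flatness hb hs (ρ / (1 + ρ) * (p.1 + p.2)))
  have hf := fXY_pos hρ0 hρ1 p.1 p.2
  simp only
  rw [fXbarYbar_eq b hρ0 hρ1, ← mul_sub_one, abs_mul, abs_of_pos hf, mul_comm,
    ← mul_div_mul_left _ _ hb.ne']
  refine mul_le_mul_of_nonneg_right ?_ hf.le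
  generalize b * (∑' k : ℤ, gpdf √ρ (b * k)) = D at *
  have hD0 : 0 < D := by linarith
  rw [div_sub_one hD0.ne', abs_div, abs_of_pos hD0, div_le_iff₀ hD0]
  exact abs_le.2 ⟨by nlinarith, by nlinarith⟩
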